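/- For any horizon T ≥ 1, the round-robin schedule minimizes the total episodic AoI among all TDMA schedules: for every TDMA schedule for K UEs with AoI sequences A_1, …, A_K, Σ_{t=1}^{T} Σ_{k=1}^{K} A_k(t) ≥ Σ_{t=1}^{T} Σ_{k=1}^{K} A_k^{RR}(t), where A_k^{RR} denotes the AoI of UE k under the round-robin schedule. Consequently the average episodic AoI (1/K) Σ_{k=1}^{K} (1/T) Σ_{t=1}^{T} A_k(t) of any TDMA schedule is at least that of the round-robin schedule. -/

import Mathlib

open scoped Classical in
/-- The AoI sequence of a UE with successful-update slot set `S ⊆ {1, 2, …}`: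
`A 0 = 1`, and for `t ≥ 1`, `A t = 1` if `t ∈ S` and `A t = A (t-1) + 1` otherwise. -/
noncomputable def aoi (S : Set ℕ) : ℕ → ℕ
  | 0 => 1
  | t + 1 => if t + 1 ∈ S then 1 else aoi S t + 1

/-- The round-robin successful-update slot set of UE `k` (for `1 ≤ k ≤ K`):
the slots `t ≥ k` with `t ≡ k (mod K)`, i.e. `{k, k + K, k + 2K, …}`. -/
def rrSet (K k : ℕ) : Set ℕ := {t | k ≤ t ∧ t % K = k % K}

lemma one_le_aoi (S : Set ℕ) (t : ℕ) : 1 ≤ aoi S t := by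
  cases t with
  | zero => simp [aoi]
  | succ t => rw [aoi]; split_ifs <;> omega

/-- An age of at most `t` at slot `t` dates back to an actual update. -/
lemma sub_aoi_mem (S : Set ℕ) (t : ℕ) (h : aoi S t ≤ t) : t + 1 - aoi S t ∈ S := by
  induction t with
  | zero => simp [aoi] at h
  | succ t ih =>
    rw [aoi] at h ⊢
    split_ifs at h ⊢ with hs
    · simpa using hs
    · have := ih (by omega)
      rwa [show t + 1 + 1 - (aoi S t + 1) = t + 1 - aoi S t by omega]

/-- Under a TDMA schedule at most `m` UEs have age at most `m`, for every `m ≤ t`. -/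
lemma card_aoi_le (I : Finset ℕ) (S : ℕ → Set ℕ)
    (hdisj : ∀ j ∈ I, ∀ k ∈ I, j ≠ k → Disjoint (S j) (S k)) {m t : ℕ} (hm : m ≤ t) :
    (I.filter fun k => aoi (S k) t ≤ m).card ≤ m := by
  calc (I.filter fun k => aoi (S k) t ≤ m).card ≤ (Finset.Icc 1 m).card := by
        refine Finset.card_le_card_of_injOn (fun k => aoi (S k) t) ?_ ?_
        · intro k hk
          have := (Finset.mem_filter.mp hk).2
          simpa using ⟨one_le_aoi (S k) t, this⟩
        · intro j hj k hk hjk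
          obtain ⟨hjI, hjm⟩ := Finset.mem_filter.mp hj
          obtain ⟨hkI, hkm⟩ := Finset.mem_filter.mp hk
          by_contra hne
          have h1 := sub_aoi_mem (S j) t (hjm.trans hm)
          have h2 := sub_aoi_mem (S k) t (hkm.trans hm)
          simp only at hjk
          rw [hjk] at h1
          exact Set.disjoint_left.mp (hdisj j hjI k hkI hne) h1 h2
    _ = m := by simp

lemma sum_sub_le_sum_aoi (I : Finset ℕ) (S : ℕ → Set ℕ)
    (hdisj : ∀ j ∈ I, ∀ k ∈ I, j ≠ k → Disjoint (S j) (S k)) (t : ℕ) :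
    ∑ m ∈ Finset.range (t + 1), (I.card - m) ≤ ∑ k ∈ I, aoi (S k) t := by
  calc ∑ m ∈ Finset.range (t + 1), (I.card - m)
      ≤ ∑ m ∈ Finset.range (t + 1), (I.filter fun k => m < aoi (S k) t).card := by
        refine Finset.sum_le_sum fun m hm => ?_
        have h1 := card_aoi_le I S hdisj (Nat.lt_succ_iff.mp (Finset.mem_range.mp hm))
        have h2 := Finset.card_filter_add_card_filter_not (s := I) (fun k => aoi (S k) t ≤ m)
        simp only [not_le] at h2
        omega
    _ = ∑ k ∈ I, ((Finset.range (t + 1)).filter fun m => m < aoi (S k) t).card := by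
        simp only [Finset.card_filter]
        exact Finset.sum_comm
    _ ≤ ∑ k ∈ I, aoi (S k) t := by
        refine Finset.sum_le_sum fun k _ => ?_
        calc _ ≤ (Finset.range (aoi (S k) t)).card :=
              Finset.card_le_card fun m hm => by
                simpa using (Finset.mem_filter.mp hm).2
          _ = _ := Finset.card_range _

/-- The UE served by round-robin in slot `t + 1` is UE `t % K + 1`. -/
lemma succ_mem_rrSet_iff {K k : ℕ} (hk : k ∈ Finset.Icc 1 K) (t : ℕ) :
    t + 1 ∈ rrSet K k ↔ k = t % K + 1 := by
  obtain ⟨k, rfl⟩ : ∃ j, k = j + 1 := ⟨k - 1, by grind⟩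
  have hkK : k < K := by grind
  have h : (t + 1) % K = (k + 1) % K ↔ t % K = k := by
    rw [← Nat.mod_eq_of_lt hkK]
    constructor
    · intro h
      rw [Nat.mod_eq_of_lt hkK] at h
      exact Nat.ModEq.add_right_cancel' 1 h
    · intro h
      rw [Nat.mod_eq_of_lt hkK] at h ⊢
      exact Nat.ModEq.add_right 1 (h.trans (Nat.mod_eq_of_lt hkK).symm)
  simp only [rrSet, Set.mem_ofPred_eq, h]
  have := Nat.mod_le t K
  omega

lemma aoi_rrSet {K k : ℕ} (hk : k ∈ Finset.Icc 1 K) (t : ℕ) :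
    aoi (rrSet K k) t = if t < k then t + 1 else (t - k) % K + 1 := by
  have hk' := Finset.mem_Icc.mp hk
  induction t with
  | zero => simp [aoi]
  | succ t ih =>
    rw [aoi, ih]
    by_cases hs : t + 1 ∈ rrSet K k
    · rw [if_pos hs]
      have h0 : (t + 1 - k) % K = 0 := Nat.sub_mod_eq_zero_of_mod_eq hs.2
      rw [if_neg (not_lt.mpr hs.1), h0]
    · rw [if_neg hs]
      by_cases h1 : t + 1 < k
      · rw [if_pos h1, if_pos (by omega)]
      · have h2 : t + 1 ≠ k := by
          rintro rfl
          exact hs ⟨le_rfl, rfl⟩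
        have hK : 1 < K := by
          by_contra hle
          exact hs ⟨by omega, by rw [show K = 1 by omega]; omega⟩
        rw [if_neg h1, if_neg (by omega), show t + 1 - k = t - k + 1 by omega,
          Nat.add_mod_of_add_mod_lt] <;> rw [Nat.mod_eq_of_lt hK]
        by_contra hge
        have hlt := Nat.mod_lt (t - k) (show 0 < K by omega)
        refine hs ⟨by omega, ?_⟩
        have hd := Nat.div_add_mod (t - k) K
        have : t + 1 = k + K * ((t - k) / K + 1) := by
          rw [Nat.mul_add]; omega
        rw [this, Nat.add_mul_mod_self_left]

/-- The UE about to be served by round-robin has age `min K (t + 1)`. -/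
lemma aoi_rrSet_served {K : ℕ} (hK : 0 < K) (t : ℕ) :
    aoi (rrSet K (t % K + 1)) t = min K (t + 1) := by
  have hlt := Nat.mod_lt t hK
  rw [aoi_rrSet (Finset.mem_Icc.mpr ⟨by omega, hlt⟩)]
  have hd := Nat.div_add_mod t K
  rcases Nat.lt_or_ge t K with h | h
  · rw [Nat.mod_eq_of_lt h, if_pos (by omega)]
    omega
  · obtain ⟨q, hq⟩ : ∃ q, t / K = q + 1 :=
      ⟨t / K - 1, by have := Nat.div_pos h hK; omega⟩
    rw [hq, Nat.mul_add] at hd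
    rw [if_neg (by omega), show t - (t % K + 1) = K - 1 + K * q by omega,
      Nat.add_mul_mod_self_left, Nat.mod_eq_of_lt (by omega)]
    omega

lemma sum_aoi_rrSet (K t : ℕ) :
    ∑ k ∈ Finset.Icc 1 K, aoi (rrSet K k) t = ∑ m ∈ Finset.range (t + 1), (K - m) := by
  rcases Nat.eq_zero_or_pos K with rfl | hK
  · simp
  induction t with
  | zero => simp [aoi]
  | succ t ih =>
    have hmem : t % K + 1 ∈ Finset.Icc 1 K :=
      Finset.mem_Icc.mpr ⟨by omega, Nat.mod_lt t hK⟩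
    have hstep : ∑ k ∈ Finset.Icc 1 K, aoi (rrSet K k) (t + 1) + min K (t + 1) =
        ∑ k ∈ Finset.Icc 1 K, aoi (rrSet K k) t + K := by
      calc _ = ∑ k ∈ Finset.Icc 1 K, (aoi (rrSet K k) (t + 1) +
              if k = t % K + 1 then aoi (rrSet K k) t else 0) := by
            rw [Finset.sum_add_distrib, Finset.sum_ite_eq', if_pos hmem, aoi_rrSet_served hK]
        _ = ∑ k ∈ Finset.Icc 1 K, (aoi (rrSet K k) t + 1) := by
            refine Finset.sum_congr rfl fun k hk => ?_
            rw [aoi]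
            simp only [succ_mem_rrSet_iff hk]
            split_ifs <;> omega
        _ = _ := by simp [Finset.sum_add_distrib]
    rw [Finset.sum_range_succ, ← ih]
    omega

/-- **Round-robin minimizes the total episodic AoI among TDMA schedules.** For any
TDMA schedule (pairwise disjoint successful-update slot sets `S k ⊆ {1, 2, …}` for
`k = 1, …, K`) and any horizon `T ≥ 1`, the total AoI over slots `1, …, T` is at
least that of the round-robin schedule; consequently the average episodic AoI of
any TDMA schedule is at least that of round-robin. -/
theorem stmt11 (K T : ℕ) (hT : 1 ≤ T) (S : ℕ → Set ℕ)
    (hS0 : ∀ k ∈ Finset.Icc 1 K, 0 ∉ S k)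
    (hdisj : ∀ j ∈ Finset.Icc 1 K, ∀ k ∈ Finset.Icc 1 K, j ≠ k → Disjoint (S j) (S k)) :
    (∑ t ∈ Finset.Icc 1 T, ∑ k ∈ Finset.Icc 1 K, aoi (S k) t
      ≥ ∑ t ∈ Finset.Icc 1 T, ∑ k ∈ Finset.Icc 1 K, aoi (rrSet K k) t) ∧
    ((1 / K : ℝ) * ∑ k ∈ Finset.Icc 1 K, (1 / T : ℝ) * ∑ t ∈ Finset.Icc 1 T, (aoi (S k) t : ℝ)
      ≥ (1 / K : ℝ) * ∑ k ∈ Finset.Icc 1 K, (1 / T : ℝ) * ∑ t ∈ Finset.Icc 1 T, (aoi (rrSet K k) t : ℝ)) := by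
  have hsum : ∑ t ∈ Finset.Icc 1 T, ∑ k ∈ Finset.Icc 1 K, aoi (rrSet K k) t
      ≤ ∑ t ∈ Finset.Icc 1 T, ∑ k ∈ Finset.Icc 1 K, aoi (S k) t := by
    refine Finset.sum_le_sum fun t _ => ?_
    rw [sum_aoi_rrSet]
    simpa using sum_sub_le_sum_aoi (Finset.Icc 1 K) S hdisj t
  refine ⟨hsum, ?_⟩
  rw [ge_iff_le, ← Finset.mul_sum, ← Finset.mul_sum, Finset.sum_comm,
    Finset.sum_comm (s := Finset.Icc 1 K)]
  have hcast : ∑ t ∈ Finset.Icc 1 T, ∑ k ∈ Finset.Icc 1 K, (aoi (rrSet K k) t : ℝ)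
      ≤ ∑ t ∈ Finset.Icc 1 T, ∑ k ∈ Finset.Icc 1 K, (aoi (S k) t : ℝ) := by
    exact_mod_cast hsum
  gcongr
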